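/- Let T', H be finite types and k ∈ ℕ. Let R : Matrix T' (Fin k) ℝ, C : Matrix (Fin k) H ℝ, M : Matrix (Fin k) (Fin k) ℝ, and U : Matrix T' (Fin k) ℝ, and suppose the k × k matrix Uᵀ ⬝ R is invertible. Set P = R ⬝ C and P' = R ⬝ M ⬝ C. Then for every matrix J : Matrix H (Fin k) ℝ satisfying (Uᵀ ⬝ P) ⬝ J = I_k (i.e., J is a right inverse of Uᵀ ⬝ P), one has Uᵀ ⬝ P' ⬝ J = (Uᵀ ⬝ R) ⬝ M ⬝ (Uᵀ ⬝ R)⁻¹. (This is the exact-recovery fact behind the spectral learning formula B_{ao} = Uᵀ P_{T,ao,H} (Uᵀ P_{T,H})^†: when the Hankel matrices factor through the true rank-k observable operator M_{ao} as P_{T,H} = R C and P_{T,ao,H} = R M_{ao} C, the spectral estimate recovers M_{ao} up to the fixed similarity transform Uᵀ R, for any choice of right inverse, in particular the Moore–Penrose pseudoinverse.) -/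

import Mathlib

open Matrix

/-- Exact recovery behind the spectral learning formula
`B_{ao} = Uᵀ P_{T,ao,H} (Uᵀ P_{T,H})^†`: when the Hankel matrices factor
through the true rank-`k` observable operator `M` as `P = R ⬝ C` and
`P' = R ⬝ M ⬝ C`, then for any right inverse `J` of `Uᵀ ⬝ P`, the spectral
estimate `Uᵀ ⬝ P' ⬝ J` equals `M` up to the similarity transform `Uᵀ ⬝ R`. -/
theorem spectral_recovery
    (T' H : Type*) [Fintype T'] [Fintype H] (k : ℕ)
    (R : Matrix T' (Fin k) ℝ) (C : Matrix (Fin k) H ℝ)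
    (M : Matrix (Fin k) (Fin k) ℝ) (U : Matrix T' (Fin k) ℝ)
    (hInv : IsUnit (Uᵀ * R))
    (P : Matrix T' H ℝ) (hP : P = R * C)
    (P' : Matrix T' H ℝ) (hP' : P' = R * M * C)
    (J : Matrix H (Fin k) ℝ) (hJ : (Uᵀ * P) * J = 1) :
    Uᵀ * P' * J = (Uᵀ * R) * M * (Uᵀ * R)⁻¹ := by
  subst hP hP'
  have hCJ : (Uᵀ * R)⁻¹ = C * J :=
    Matrix.inv_eq_right_inv (by simpa only [Matrix.mul_assoc] using hJ)
  rw [hCJ]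
  simp only [Matrix.mul_assoc]
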